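/- (Theorem 2) For every integer n ≥ 0, D_{−2,n+3}(q) = −q^{2C(n,2)} d_{0,n+1}(q) · r_{2,n}(q), where the polynomials r_{2,n}(q) are defined recursively by r_{2,0}(q) = 1 and r_{2,n}(q) = r_{1,n}(q)^2 + (q^{n+1}−1) q^{n+2} r_{2,n−1}(q) for n ≥ 1. -/

import Mathlib

open Polynomial Finset

noncomputable section

/-- `C2 m` is the binomial coefficient `C(m,2) = m(m-1)/2` for `m : ℤ`
(a nonnegative integer for every integer `m`). -/
def C2 (m : ℤ) : ℕ := (m * (m - 1) / 2).toNat

/-- The q-integer `[n]_q = 1 + q + ⋯ + q^{n-1}` in `ℤ[q]` (with `q = X`). -/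
def qInt (n : ℕ) : Polynomial ℤ := ∑ i ∈ Finset.range n, X ^ i

/-- The q-factorial `[n]_q! = [1]_q [2]_q ⋯ [n]_q`, with `[0]_q! = 1`. -/
def qFact : ℕ → Polynomial ℤ
  | 0 => 1
  | n + 1 => qFact n * qInt (n + 1)

/-- `a(n,q) = q^{C(n,2)}` for `n ≥ 0` and `a(n,q) = 0` for `n < 0`. -/
def a (m : ℤ) : Polynomial ℤ := if m < 0 then 0 else X ^ C2 m

/-- The Hankel determinant `d_{m,n}(q) = det(q^{C(m+i+j,2)})_{i,j=0}^{n-1}`. -/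
def dd (m : ℤ) (n : ℕ) : Polynomial ℤ :=
  Matrix.det (Matrix.of fun i j : Fin n => (X : Polynomial ℤ) ^ C2 (m + (i : ℤ) + (j : ℤ)))

/-- The Hankel determinant `D_{m,n}(q) = det(a(m+i+j,q))_{i,j=0}^{n-1}`. -/
def DD (m : ℤ) (n : ℕ) : Polynomial ℤ :=
  Matrix.det (Matrix.of fun i j : Fin n => a (m + (i : ℤ) + (j : ℤ)))

/-- `v_{k,n}(q) = det(a(k-n+i+j,q))_{i,j=0}^{n-1}`. -/
def vv (k : ℤ) (n : ℕ) : Polynomial ℤ :=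
  Matrix.det (Matrix.of fun i j : Fin n => a (k - (n : ℤ) + (i : ℤ) + (j : ℤ)))

/-- `r_{1,n}(q) = q^{C(n+2,2)} - (q-1)^{n+1} [n+1]_q!`. -/
def r1 (n : ℕ) : Polynomial ℤ := X ^ ((n + 2).choose 2) - (X - 1) ^ (n + 1) * qFact (n + 1)

/-- `r_{2,n}(q)`, defined by `r_{2,0} = 1` and
`r_{2,n} = r_{1,n}^2 + (q^{n+1}-1) q^{n+2} r_{2,n-1}` for `n ≥ 1`. -/
def r2 : ℕ → Polynomial ℤ
  | 0 => 1
  | n + 1 => (r1 (n + 1)) ^ 2 + (X ^ (n + 2) - 1) * X ^ (n + 3) * r2 n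

/-- The Hankel determinant `det (f (i + j))` of size `n` attached to a sequence `f`. -/
def hankelDet {R : Type*} [CommRing R] (f : ℕ → R) (n : ℕ) : R :=
  Matrix.det (Matrix.of fun i j : Fin n => f (i + j))

/-- Jacobi's identity for the complementary minor of the adjugate, before cancelling `M.det`. -/
theorem det_mul_det_adjugate_toBlocks₂₂ {R m l : Type*} [CommRing R] [Fintype m] [Fintype l]
    [DecidableEq m] [DecidableEq l] (M : Matrix (m ⊕ l) (m ⊕ l) R) :
    M.det * M.adjugate.toBlocks₂₂.det = M.toBlocks₁₁.det * M.det ^ Fintype.card l := by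
  have key : M * Matrix.fromBlocks 1 M.adjugate.toBlocks₁₂ 0 M.adjugate.toBlocks₂₂ =
      Matrix.fromBlocks M.toBlocks₁₁ 0 M.toBlocks₂₁ (M.det • 1) := by
    have h := M.mul_adjugate
    rw [← Matrix.fromBlocks_toBlocks M, ← Matrix.fromBlocks_toBlocks (Matrix.adjugate _),
      Matrix.fromBlocks_multiply, ← Matrix.fromBlocks_one, Matrix.fromBlocks_smul,
      Matrix.fromBlocks_inj] at h
    simp only [Matrix.fromBlocks_toBlocks] at h
    conv_lhs => rw [← Matrix.fromBlocks_toBlocks M, Matrix.fromBlocks_multiply]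
    simp only [Matrix.fromBlocks_toBlocks]
    rw [h.2.1, h.2.2.2]
    simp
  have h := congrArg Matrix.det key
  rwa [Matrix.det_mul, Matrix.det_fromBlocks_zero₂₁, Matrix.det_fromBlocks_zero₁₂, Matrix.det_one,
    one_mul, Matrix.det_smul, Matrix.det_one, mul_one] at h

/-- The middle indices of `Fin (n + 2)` together with its two end points. -/
def middleEndsEquiv (n : ℕ) : Fin n ⊕ Fin 2 ≃ Fin (n + 2) :=
  Equiv.ofBijective (Sum.elim (fun i => i.succ.castSucc) ![0, Fin.last (n + 1)]) <| by
    rw [Fintype.bijective_iff_injective_and_card]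
    refine ⟨?_, by simp⟩
    rintro (i | i) (j | j) h
    · simpa using h
    · fin_cases j <;> simp [Fin.ext_iff] at h <;> omega
    · fin_cases i <;> simp [Fin.ext_iff] at h <;> omega
    · fin_cases i <;> fin_cases j <;> simp [Fin.ext_iff] at h ⊢

/-- The **Desnanot–Jacobi identity**, multiplied by `A.det`. -/
theorem det_mul_desnanot_jacobi {R : Type*} [CommRing R] {n : ℕ}
    (A : Matrix (Fin (n + 2)) (Fin (n + 2)) R) :
    A.det * (A.adjugate 0 0 * A.adjugate (Fin.last _) (Fin.last _) -
      A.adjugate 0 (Fin.last _) * A.adjugate (Fin.last _) 0) =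
    A.det * (A.det *
      (A.submatrix (fun i : Fin n => i.succ.castSucc) fun i => i.succ.castSucc).det) := by
  have h := det_mul_det_adjugate_toBlocks₂₂
    (A.submatrix (middleEndsEquiv n) (middleEndsEquiv n))
  rw [Matrix.adjugate_submatrix_equiv_self, Matrix.det_submatrix_equiv_self,
    Matrix.det_fin_two, Fintype.card_fin] at h
  have h' : (A.submatrix (middleEndsEquiv n) (middleEndsEquiv n)).toBlocks₁₁ =
      A.submatrix (fun i : Fin n => i.succ.castSucc) fun i => i.succ.castSucc := rfl
  rw [h'] at h
  simp only [Matrix.toBlocks₂₂, Matrix.of_apply, Matrix.submatrix_apply, middleEndsEquiv,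
    Equiv.ofBijective_apply, Sum.elim_inr, Matrix.cons_val_zero, Matrix.cons_val_one] at h
  rw [h]
  ring

/-- The **Desnanot–Jacobi identity** (Dodgson condensation), in terms of the adjugate. -/
theorem desnanot_jacobi {R : Type*} [CommRing R] {n : ℕ}
    (A : Matrix (Fin (n + 2)) (Fin (n + 2)) R) :
    A.adjugate 0 0 * A.adjugate (Fin.last _) (Fin.last _) -
      A.adjugate 0 (Fin.last _) * A.adjugate (Fin.last _) 0 =
    A.det * (A.submatrix (fun i : Fin n => i.succ.castSucc) fun i => i.succ.castSucc).det := by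
  have h := mul_left_cancel₀ (Matrix.det_mvPolynomialX_ne_zero (Fin (n + 2)) ℤ)
    (det_mul_desnanot_jacobi (Matrix.mvPolynomialX (Fin (n + 2)) (Fin (n + 2)) ℤ))
  let φ := MvPolynomial.eval₂Hom (Int.castRingHom R) fun p : Fin (n + 2) × Fin (n + 2) => A p.1 p.2
  have hA : φ.mapMatrix (Matrix.mvPolynomialX (Fin (n + 2)) (Fin (n + 2)) ℤ) = A := by
    ext i j
    simp [φ]
  have hadj (i j) : φ ((Matrix.mvPolynomialX (Fin (n + 2)) (Fin (n + 2)) ℤ).adjugate i j) =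
      A.adjugate i j := by
    rw [← hA, ← RingHom.map_adjugate]
    rfl
  have h' := congrArg φ h
  simp only [map_sub, map_mul, hadj] at h'
  rw [RingHom.map_det, RingHom.map_det, hA] at h'
  rw [h', ← hA]
  rfl

theorem hankelDet_condensation {R : Type*} [CommRing R] (f : ℕ → R) (n : ℕ) :
    hankelDet f (n + 2) * hankelDet (fun k => f (k + 2)) n =
      hankelDet f (n + 1) * hankelDet (fun k => f (k + 2)) (n + 1) -
        hankelDet (fun k => f (k + 1)) (n + 1) ^ 2 := by
  have h := desnanot_jacobi (Matrix.of fun i j : Fin (n + 2) => f (i + j))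
  simp only [Matrix.adjugate_fin_succ_eq_det_submatrix, Fin.succAbove_last] at h
  have h1 : (Matrix.of fun i j : Fin (n + 2) => f (i + j)).submatrix
      (fun i : Fin n => i.succ.castSucc) (fun i => i.succ.castSucc) =
      Matrix.of fun i j : Fin n => f (i + j + 2) := by
    ext i j; simp; congr 1; omega
  have h2 : (Matrix.of fun i j : Fin (n + 2) => f (i + j)).submatrix
      (Fin.succAbove 0) (Fin.succAbove 0) =
      Matrix.of fun i j : Fin (n + 1) => f (i + j + 2) := by
    ext i j; simp; congr 1; omega
  have h3 : (Matrix.of fun i j : Fin (n + 2) => f (i + j)).submatrix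
      Fin.castSucc (Fin.succAbove 0) = Matrix.of fun i j : Fin (n + 1) => f (i + j + 1) := by
    ext i j; simp; congr 1
  have h4 : (Matrix.of fun i j : Fin (n + 2) => f (i + j)).submatrix
      (Fin.succAbove 0) Fin.castSucc = Matrix.of fun i j : Fin (n + 1) => f (i + j + 1) := by
    ext i j; simp; congr 1; omega
  have h5 : (Matrix.of fun i j : Fin (n + 2) => f (i + j)).submatrix
      Fin.castSucc Fin.castSucc = Matrix.of fun i j : Fin (n + 1) => f (i + j) := by
    ext i j; simp
  rw [h1, h2, h3, h4, h5] at h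
  have hs : ((-1 : R) ^ (n + 1)) ^ 2 = 1 := by rw [← pow_mul, mul_comm, pow_mul]; simp
  simp only [Fin.val_zero, Fin.val_last, add_zero, zero_add, pow_zero, one_mul, pow_add] at h hs
  unfold hankelDet
  linear_combination (-1 : R) * h + ((Matrix.of fun i j : Fin (n + 1) => f (i + j + 2)).det *
    (Matrix.of fun i j : Fin (n + 1) => f (i + j)).det -
      (Matrix.of fun i j : Fin (n + 1) => f (i + j + 1)).det ^ 2) * hs

/-- Changing the top left entry of a Hankel matrix. -/
theorem hankelDet_congr_succ {R : Type*} [CommRing R] {f g : ℕ → R}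
    (h : ∀ k, f (k + 1) = g (k + 1)) (n : ℕ) :
    hankelDet f (n + 1) = hankelDet g (n + 1) +
      (f 0 - g 0) * hankelDet (fun k => g (k + 2)) n := by
  have hm (j : Fin (n + 1)) : (Matrix.of fun i j : Fin (n + 1) => f (i + j)).submatrix Fin.succ
      j.succAbove = (Matrix.of fun i j : Fin (n + 1) => g (i + j)).submatrix Fin.succ
      j.succAbove := by
    ext i k
    simp only [Matrix.submatrix_apply, Matrix.of_apply, Fin.val_succ]
    rw [add_right_comm, h]
  have h0 : (Matrix.of fun i j : Fin (n + 1) => g (i + j)).submatrix Fin.succ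
      (Fin.succAbove 0) = Matrix.of fun i j : Fin n => g (i + j + 2) := by
    ext i j; simp; congr 1; omega
  unfold hankelDet
  rw [Matrix.det_succ_row_zero, Matrix.det_succ_row_zero, Fin.sum_univ_succ, Fin.sum_univ_succ]
  simp only [hm, h0, Matrix.of_apply, Fin.val_zero, Fin.val_succ, zero_add, h]
  ring

theorem hankelDet_mul_left_right {R : Type*} [CommRing R] {f g : ℕ → R} {u : ℕ → R}
    (h : ∀ i j, g (i + j) = u i * u j * f (i + j)) (n : ℕ) :
    hankelDet g n = (∏ i ∈ range n, u i) ^ 2 * hankelDet f n := by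
  unfold hankelDet
  have := Matrix.det_mul_row (fun j : Fin n => u j)
    (Matrix.of fun i j : Fin n => u i * (Matrix.of fun i j : Fin n => f (i + j)) i j)
  rw [Matrix.det_mul_column] at this
  rw [Finset.prod_range, sq, mul_assoc, ← this]
  congr 1
  ext i j
  simp only [Matrix.of_apply, h]
  ring

theorem hankelDet_const_mul {R : Type*} [CommRing R] (c : R) (f : ℕ → R) (n : ℕ) :
    hankelDet (fun k => c * f k) n = c ^ n * hankelDet f n := by
  unfold hankelDet
  have := Matrix.det_smul (Matrix.of fun i j : Fin n => f (i + j)) c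
  rw [Fintype.card_fin] at this
  rw [← this]
  rfl

theorem prod_range_pow_id {R : Type*} [CommRing R] (x : R) (n : ℕ) :
    ∏ i ∈ range n, x ^ i = x ^ n.choose 2 := by
  rw [Finset.prod_pow_eq_pow_sum, Finset.sum_range_id, Nat.choose_two_right]

theorem choose_two_succ (n : ℕ) : (n + 1).choose 2 = n + n.choose 2 := by
  simp [Nat.choose_succ_succ' n 1]

theorem choose_two_add (i j : ℕ) :
    (i + j).choose 2 = i.choose 2 + j.choose 2 + i * j := by
  induction j with
  | zero => simp
  | succ j ih =>
    rw [← add_assoc, choose_two_succ, choose_two_succ, ih]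
    ring

theorem two_mul_choose_two (n : ℕ) : 2 * n.choose 2 + n = n * n := by
  induction n with
  | zero => simp
  | succ n ih =>
    rw [choose_two_succ]
    linarith

theorem det_vandermonde_geometric_succ {R : Type*} [CommRing R] (x : R) (n : ℕ) :
    (Matrix.vandermonde fun i : Fin (n + 1) => x ^ (i : ℕ)).det =
      (∏ i ∈ range n, (x ^ (i + 1) - 1)) * (x ^ n.choose 2 *
        (Matrix.vandermonde fun i : Fin n => x ^ (i : ℕ)).det) := by
  have h : x ^ n.choose 2 * (Matrix.vandermonde fun i : Fin n => x ^ (i : ℕ)).det =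
      (Matrix.vandermonde fun i : Fin n => x ^ ((i : ℕ) + 1)).det := by
    rw [← prod_range_pow_id, Finset.prod_range, ← Matrix.det_mul_row]
    congr 1
    ext i j
    simp only [Matrix.of_apply, Matrix.vandermonde_apply]
    ring
  rw [h, Matrix.det_vandermonde, Matrix.det_vandermonde, Fin.prod_univ_succ, Fin.prod_Ioi_zero,
    Finset.prod_range]
  simp [Fin.prod_Ioi_succ]

theorem hankelDet_pow_choose_two {R : Type*} [CommRing R] (x : R) (n : ℕ) :
    hankelDet (fun k => x ^ k.choose 2) n = (∏ i ∈ range n, x ^ i.choose 2) ^ 2 *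
      (Matrix.vandermonde fun i : Fin n => x ^ (i : ℕ)).det := by
  unfold hankelDet
  have := Matrix.det_mul_row (fun j : Fin n => x ^ (j : ℕ).choose 2)
    (Matrix.of fun i j : Fin n => x ^ (i : ℕ).choose 2 *
      (Matrix.vandermonde fun i : Fin n => x ^ (i : ℕ)) i j)
  rw [Matrix.det_mul_column] at this
  rw [Finset.prod_range, sq, mul_assoc, ← this]
  congr 1
  ext i j
  simp only [Matrix.of_apply, Matrix.vandermonde_apply, choose_two_add]
  ring

theorem hankelDet_pow_choose_two_succ {R : Type*} [CommRing R] (x : R) (n : ℕ) :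
    hankelDet (fun k => x ^ k.choose 2) (n + 1) = x ^ (3 * n.choose 2) *
      (∏ i ∈ range n, (x ^ (i + 1) - 1)) * hankelDet (fun k => x ^ k.choose 2) n := by
  rw [hankelDet_pow_choose_two, hankelDet_pow_choose_two, det_vandermonde_geometric_succ,
    Finset.prod_range_succ]
  ring

theorem X_sub_one_pow_mul_qFact (n : ℕ) :
    (X - 1) ^ n * qFact n = ∏ i ∈ range n, ((X : ℤ[X]) ^ (i + 1) - 1) := by
  induction n with
  | zero => simp [qFact]
  | succ n ih =>
    rw [Finset.prod_range_succ, ← ih, qFact, qInt, ← mul_geom_sum]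
    ring

theorem hankelDet_X_pow_choose_two_ne_zero (n : ℕ) :
    hankelDet (fun k => (X : ℤ[X]) ^ k.choose 2) n ≠ 0 := by
  induction n with
  | zero => simp [hankelDet]
  | succ n ih =>
    rw [hankelDet_pow_choose_two_succ]
    refine mul_ne_zero (mul_ne_zero (pow_ne_zero _ X_ne_zero) ?_) ih
    exact Finset.prod_ne_zero_iff.2 fun i _ => X_pow_sub_C_ne_zero i.succ_pos 1

theorem C2_natCast (k : ℕ) : C2 k = k.choose 2 := by
  have h : (k : ℤ) * (k - 1) / 2 = (k.choose 2 : ℕ) := by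
    have := two_mul_choose_two k
    zify at this
    rw [show (k : ℤ) * (k - 1) = 2 * (k.choose 2 : ℕ) by linarith]
    simp
  rw [C2, h, Int.toNat_natCast]

theorem a_natCast (k : ℕ) : a k = X ^ k.choose 2 := by
  rw [a, if_neg (by omega), C2_natCast]

theorem dd_zero_eq_hankelDet (n : ℕ) :
    dd 0 n = hankelDet (fun k => (X : ℤ[X]) ^ k.choose 2) n := by
  unfold dd hankelDet
  congr 1
  ext1 i j
  rw [Matrix.of_apply, Matrix.of_apply, zero_add, ← Nat.cast_add, C2_natCast]

theorem DD_eq_hankelDet (m : ℤ) (n : ℕ) : DD m n = hankelDet (fun k => a (m + k)) n := by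
  simp only [DD, hankelDet, Nat.cast_add, add_assoc]

/-- The evaluation of `D_{-1,n+2}(q)` in terms of `r_{1,n}(q)`. -/
theorem hankelDet_a_neg_one (n : ℕ) :
    hankelDet (fun k => a (-1 + k)) (n + 2) =
      -(X ^ n.choose 2 * hankelDet (fun k => (X : ℤ[X]) ^ k.choose 2) (n + 1) * r1 n) := by
  let g : ℕ → ℤ[X] := fun k => k.casesOn X fun k => X ^ k.choose 2
  have hg : ∀ k, a (-1 + ((k + 1 : ℕ) : ℤ)) = g (k + 1) := fun k => by
    rw [show -1 + ((k + 1 : ℕ) : ℤ) = k by push_cast; ring, a_natCast]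
  have hshift : hankelDet (fun k => g (k + 2)) (n + 1) = (X ^ (n + 1).choose 2) ^ 2 *
      hankelDet (fun k => (X : ℤ[X]) ^ k.choose 2) (n + 1) := by
    rw [← prod_range_pow_id]
    refine hankelDet_mul_left_right (g := fun k => g (k + 2)) (fun i j => ?_) _
    change X ^ (i + j + 1).choose 2 = _
    rw [choose_two_succ]
    ring
  have hback : X ^ (n + 2) * hankelDet (fun k => (X : ℤ[X]) ^ k.choose 2) (n + 2) =
      (X ^ (n + 2).choose 2) ^ 2 * hankelDet g (n + 2) := by
    rw [← prod_range_pow_id, ← hankelDet_const_mul]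
    refine hankelDet_mul_left_right (g := fun k => X * X ^ k.choose 2) (fun i j => ?_) _
    rw [← pow_add]
    rcases i + j with - | k
    · simp [g]
    · change _ = _ * X ^ k.choose 2
      rw [choose_two_succ]
      ring
  have hg' : hankelDet g (n + 2) = X ^ n.choose 2 * ((X - 1) ^ (n + 1) * qFact (n + 1)) *
      hankelDet (fun k => (X : ℤ[X]) ^ k.choose 2) (n + 1) := by
    refine mul_left_cancel₀ (pow_ne_zero 2 (pow_ne_zero ((n + 2).choose 2) X_ne_zero)) ?_
    rw [← hback, hankelDet_pow_choose_two_succ X (n + 1), X_sub_one_pow_mul_qFact]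
    simp only [choose_two_succ]
    ring
  rw [hankelDet_congr_succ hg, hshift, hg', r1]
  have h0 : a (-1 + ((0 : ℕ) : ℤ)) - g 0 = -X := by simp [a, g]
  have he : (X : ℤ[X]) * (X ^ (n + 1).choose 2) ^ 2 = X ^ n.choose 2 * X ^ (n + 2).choose 2 := by
    rw [← pow_mul, ← pow_succ', ← pow_add]
    simp only [choose_two_succ]
    congr 1
    ring
  rw [h0]
  linear_combination (-hankelDet (fun k => (X : ℤ[X]) ^ k.choose 2) (n + 1)) * he

/-- Theorem 2: `D_{-2,n+3}(q) = - q^{2 C(n,2)} d_{0,n+1}(q) r_{2,n}(q)`. -/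
theorem stmt6 (n : ℕ) :
    DD (-2) (n + 3) = -(X ^ (2 * n.choose 2) * dd 0 (n + 1) * r2 n) := by
  rw [DD_eq_hankelDet, dd_zero_eq_hankelDet]
  induction n with
  | zero =>
    have h0 : a (-2) = 0 := rfl
    have h1 : a (-1) = 0 := rfl
    have h2 : a 0 = 1 := rfl
    simp [hankelDet, Matrix.det_fin_three, r2, h0, h1, h2]
  | succ n ih =>
    have h := hankelDet_condensation (fun k => a (-2 + k)) (n + 2)
    have h1 : (fun k : ℕ => a (-2 + ((k + 1 : ℕ) : ℤ))) = fun k : ℕ => a (-1 + k) := by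
      funext k; congr 1; push_cast; ring
    have h2 : (fun k : ℕ => a (-2 + ((k + 2 : ℕ) : ℤ))) = fun k => X ^ k.choose 2 := by
      funext k
      rw [← a_natCast]; congr 1; push_cast; ring
    rw [h1, h2, ih, hankelDet_a_neg_one (n + 1), hankelDet_pow_choose_two_succ X (n + 2)] at h
    refine mul_right_cancel₀ (hankelDet_X_pow_choose_two_ne_zero (n + 2)) (h.trans ?_)
    rw [Finset.prod_range_succ, r2]
    have h3 := hankelDet_pow_choose_two_succ (X : ℤ[X]) (n + 1)
    simp only [choose_two_succ] at h3 ⊢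
    rw [h3]
    ring

end
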